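/- Let p be a prime number and K a field with char K ≠ p that contains a primitive p-th root of unity. Then for every positive integer r, ed_K((Z/pZ)^r) = r. In particular, for a field K with char K ≠ 2, ed_K((Z/2Z)^r) = r. -/

import Mathlib

noncomputable section

/-- The transcendence degree of `L` over `K`: the supremum of the cardinalities of
algebraically independent subsets of `L`. -/
noncomputable def trdeg (K L : Type*) [CommRing K] [CommRing L] [Algebra K L] : Cardinal :=
  ⨆ s : {s : Set L // AlgebraicIndependent K ((↑) : s → L)}, Cardinal.mk s.1

/-- The rational function field over `K` on variables indexed by `σ` :
the fraction field of the polynomial ring `K[x_i : i ∈ σ]`. -/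
abbrev FnField (K : Type*) [Field K] (σ : Type*) : Type _ :=
  FractionRing (MvPolynomial σ K)

/-- Permutations of the variables acting on the polynomial ring by `K`-algebra
automorphisms. -/
noncomputable def permHom (K : Type*) [Field K] (σ : Type*) :
    Equiv.Perm σ →* (MvPolynomial σ K ≃ₐ[K] MvPolynomial σ K) where
  toFun e := MvPolynomial.renameEquiv K e
  map_one' := MvPolynomial.renameEquiv_refl K
  map_mul' e f := by
    ext x
    simp [MvPolynomial.renameEquiv, Equiv.Perm.mul_apply]

/-- Permutations of the variables acting on the rational function field by
`K`-algebra automorphisms. -/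
noncomputable def permGalAction (K : Type*) [Field K] (σ : Type*) :
    Equiv.Perm σ →* (FnField K σ ≃ₐ[K] FnField K σ) :=
  (IsFractionRing.fieldEquivOfAlgEquivHom K (FnField K σ)).comp (permHom K σ)

/-- The action of a group `G` on its rational function field `K(x_g : g ∈ G)` by
`K`-algebra automorphisms, permuting the variables by left translation:
`σ • x_g = x_{σg}`. -/
noncomputable def galAction (K : Type*) [Field K] (G : Type*) [Group G] :
    G →* (FnField K G ≃ₐ[K] FnField K G) :=
  (permGalAction K G).comp (MulAction.toPermHom G G)

/-- The essential dimension of a group `G` over the field `K`: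
the minimum of the transcendence degrees over `K` of the `G`-stable intermediate
subfields of the rational function field `K(x_g : g ∈ G)` on which `G` acts
faithfully. -/
noncomputable def edK (K : Type*) [Field K] (G : Type*) [Group G] : ℕ :=
  sInf { d : ℕ | ∃ E : IntermediateField K (FnField K G),
    (∀ g : G, ∀ x ∈ E, galAction K G g x ∈ E) ∧
    (∀ g : G, g ≠ 1 → ∃ x ∈ E, galAction K G g x ≠ x) ∧
    trdeg K E = d }

section MonomialOrder

open MvPolynomial

/-- Nonzero polynomials with pairwise distinct degrees are linearly independent. -/
lemma linearIndependent_of_injective_degree {K τ ι : Type*} [Field K] (M : MonomialOrder τ)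
    (f : ι → MvPolynomial τ K) (hf : ∀ i, f i ≠ 0)
    (hinj : Function.Injective fun i => M.degree (f i)) : LinearIndependent K f := by
  classical
  rw [linearIndependent_iff']
  intro s c hsum
  by_contra! hc
  obtain ⟨i, his, hci⟩ := hc
  obtain ⟨j, hj, hmax⟩ := (s.filter fun i => c i ≠ 0).exists_max_image
    (fun i => M.toSyn (M.degree (f i))) ⟨i, by simp [his, hci]⟩
  simp only [Finset.mem_filter] at hj hmax
  have hcoeff := congrArg (coeff (M.degree (f j))) hsum
  rw [coeff_sum, Finset.sum_eq_single j, coeff_zero, coeff_smul, smul_eq_mul, mul_eq_zero] at hcoeff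
  · exact hcoeff.elim hj.2 (M.coeff_degree_ne_zero_iff.2 (hf j))
  · intro k hk hkj
    rw [coeff_smul, smul_eq_mul]
    by_cases hck : c k = 0
    · simp [hck]
    · rw [M.coeff_eq_zero_of_lt, mul_zero]
      refine lt_of_le_of_ne (hmax k ⟨hk, hck⟩) fun h => hkj (hinj (M.toSyn.injective h))
  · exact fun h => (h hj.1).elim

/-- Fractions whose degrees are linearly independent over `ℤ` are algebraically independent. -/
lemma algebraicIndependent_of_linearIndependent_degree {K τ ι A L : Type*} [Field K] [Fintype ι]
    [CommRing A] [Algebra K A] [Field L] [Algebra K L] [Algebra A L] [IsScalarTower K A L]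
    [FaithfulSMul A L] (M : MonomialOrder τ) (ψ : A →ₐ[K] MvPolynomial τ K)
    (hψ : Function.Injective ψ) (e : ι → L) (a : ι → A) (b : A) (ha : ∀ i, a i ≠ 0) (hb : b ≠ 0)
    (he : ∀ i, algebraMap A L (a i) = algebraMap A L b * e i)
    (hv : LinearIndependent ℤ fun i s => (M.degree (ψ (a i)) s : ℤ) - M.degree (ψ b) s) :
    AlgebraicIndependent K e := by
  classical
  have hinjL : Function.Injective (algebraMap A L) := FaithfulSMul.algebraMap_injective A L
  have hψa : ∀ i, ψ (a i) ≠ 0 := fun i => (map_ne_zero_iff ψ hψ).2 (ha i)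
  have hψb : ψ b ≠ 0 := (map_ne_zero_iff ψ hψ).2 hb
  rw [algebraicIndependent_iff]
  intro P hP
  set N := P.totalDegree
  set f : P.support → A := fun m => b ^ (N - ∑ i, m.1 i) * ∏ i, a i ^ m.1 i with hf
  have hle : ∀ m : P.support, ∑ i, m.1 i ≤ N := fun m => by
    have := le_totalDegree m.2
    rwa [Finsupp.sum_fintype _ _ fun _ => rfl] at this
  have hfL : ∀ m : P.support, algebraMap A L (f m) = algebraMap A L b ^ N * ∏ i, e i ^ m.1 i := by
    intro m
    simp only [hf, map_mul, map_pow, map_prod, he, mul_pow, Finset.prod_mul_distrib,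
      Finset.prod_pow_eq_pow_sum]
    rw [← mul_assoc, ← pow_add, Nat.sub_add_cancel (hle m)]
  have hdeg : ∀ (m : P.support) s, (M.degree (ψ (f m)) s : ℤ) = N * M.degree (ψ b) s +
      ∑ i, (m.1 i : ℤ) * ((M.degree (ψ (a i)) s : ℤ) - M.degree (ψ b) s) := by
    intro m s
    simp only [hf, map_mul, map_pow, map_prod]
    rw [M.degree_mul (pow_ne_zero _ hψb)
      (Finset.prod_ne_zero_iff.2 fun i _ => pow_ne_zero _ (hψa i)),
      M.degree_prod fun i _ => pow_ne_zero _ (hψa i)]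
    simp only [M.degree_pow, Finsupp.add_apply, Finsupp.finsetSum_apply, Finsupp.smul_apply,
      smul_eq_mul]
    push_cast [Nat.cast_sub (hle m)]
    simp only [mul_sub, Finset.sum_sub_distrib, sub_mul, Finset.sum_mul]
    ring
  have hlin := linearIndependent_of_injective_degree M (fun m => ψ (f m))
    (fun m => by
      simp only [hf, map_mul, map_pow, map_prod]
      exact mul_ne_zero (pow_ne_zero _ hψb)
        (Finset.prod_ne_zero_iff.2 fun i _ => pow_ne_zero _ (hψa i)))
    (by
      intro m m' h
      have hz := Fintype.linearIndependent_iff.1 hv (fun i => (m.1 i : ℤ) - m'.1 i) (by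
        funext s
        have h1 := hdeg m s
        have h2 := hdeg m' s
        have h3 : M.degree (ψ (f m)) = M.degree (ψ (f m')) := h
        rw [h3] at h1
        simp only [Finset.sum_apply, Pi.smul_apply, smul_eq_mul, Pi.zero_apply, sub_mul,
          Finset.sum_sub_distrib]
        simp only [mul_sub, Finset.sum_sub_distrib] at h1 h2 ⊢
        linarith)
      ext i
      have := hz i
      omega)
  have hzero : ∑ m : P.support, coeff m.1 P • ψ (f m) = 0 := by
    have h0 : ∑ m : P.support, coeff m.1 P • f m = 0 := by
      apply hinjL
      rw [map_sum, map_zero]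
      simp_rw [Algebra.smul_def, map_mul, ← IsScalarTower.algebraMap_apply, hfL]
      rw [aeval_def, eval₂_eq', ← Finset.sum_coe_sort] at hP
      rw [← mul_zero (algebraMap A L b ^ N), ← hP, Finset.mul_sum]
      exact Finset.sum_congr rfl fun m _ => by ring
    rw [← map_zero ψ, ← h0, map_sum]
    simp
  have hc := Fintype.linearIndependent_iff.1 hlin _ hzero
  ext m
  by_cases hm : m ∈ P.support
  · simpa using hc ⟨m, hm⟩
  · simpa using hm

lemma coeff_aeval_C_mul_X {K τ : Type*} [Field K] (c : τ → K) (F : MvPolynomial τ K)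
    (m : τ →₀ ℕ) :
    coeff m (aeval (fun s => C (c s) * X s) F) = (m.prod fun s n => c s ^ n) * coeff m F := by
  classical
  induction F using MvPolynomial.induction_on' with
  | monomial u x =>
    have : aeval (fun s => C (c s) * X s) (monomial u x)
        = monomial u ((u.prod fun s n => c s ^ n) * x) := by
      rw [aeval_monomial, monomial_eq, C_mul, Finsupp.prod, Finsupp.prod, Finsupp.prod, map_prod]
      simp only [mul_pow, Finset.prod_mul_distrib, map_pow, algebraMap_eq]
      ring
    rw [this, coeff_monomial, coeff_monomial]
    split_ifs with h
    · rw [h]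
    · simp
  | add p q hp hq => rw [map_add, coeff_add, coeff_add, hp, hq, mul_add]

lemma degree_aeval_C_mul_X {K τ : Type*} [Field K] (M : MonomialOrder τ) (c : τ → K)
    (hc : ∀ s, c s ≠ 0) (F : MvPolynomial τ K) :
    M.degree (aeval (fun s => C (c s) * X s) F) = M.degree F := by
  have : (aeval (fun s => C (c s) * X s) F).support = F.support := by
    ext m
    rw [mem_support_iff, mem_support_iff, coeff_aeval_C_mul_X]
    refine ⟨right_ne_zero_of_mul, mul_ne_zero (Finset.prod_ne_zero_iff.2 fun s _ => ?_)⟩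
    exact pow_ne_zero _ (hc s)
  simp only [MonomialOrder.degree, this]

end MonomialOrder

/-- Integral vectors that map to the standard basis modulo `p` are linearly independent. -/
lemma linearIndependent_int_of_map_eq_single {ι τ : Type*} [Fintype ι] [DecidableEq ι] {p : ℕ}
    (hp : 1 < p) (v : ι → τ → ℤ) (W : (τ → ℤ) →+ (ι → ZMod p))
    (hW : ∀ i, W (v i) = Pi.single i 1) : LinearIndependent ℤ v := by
  rw [Fintype.linearIndependent_iff]
  have key : ∀ n : ℕ, ∀ k : ι → ℤ, ∑ i, k i • v i = 0 → ∀ i, (p : ℤ) ^ n ∣ k i := by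
    intro n
    induction n with
    | zero => simp
    | succ n ih =>
      intro k hk
      have hdvd : ∀ i, (p : ℤ) ∣ k i := by
        intro i
        have h := congrFun (congrArg W hk) i
        simp only [map_sum, map_zsmul, hW] at h
        rw [← ZMod.intCast_zmod_eq_zero_iff_dvd]
        simpa [Finset.sum_apply, Pi.single_apply] using h
      choose k' hk' using hdvd
      intro i
      rw [hk' i, pow_succ']
      refine mul_dvd_mul_left _ (ih k' ?_ i)
      have : (p : ℤ) • ∑ i, k' i • v i = 0 := by
        rw [Finset.smul_sum, ← hk]
        exact Finset.sum_congr rfl fun i _ => by rw [hk' i, mul_smul]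
      exact (smul_eq_zero.1 this).resolve_left (by positivity)
  intro k hk i
  by_contra h
  obtain ⟨n, hn⟩ := pow_unbounded_of_one_lt (k i).natAbs hp
  have := Int.natAbs_dvd_natAbs.2 (key n k hk i)
  rw [Int.natAbs_pow, Int.natAbs_natCast] at this
  exact absurd (Nat.le_of_dvd (Int.natAbs_pos.2 h) this) (not_le.2 hn)

/-- A faithful stable subfield contains an eigenvector for every linear character. -/
lemma exists_eigenvector {K L G : Type*} [Field K] [Field L] [Algebra K L] [Group G] [Finite G]
    (ρ : G →* (L ≃ₐ[K] L)) (E : IntermediateField K L) (hE : ∀ g, ∀ x ∈ E, ρ g x ∈ E)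
    (hfaith : ∀ g, g ≠ 1 → ∃ x ∈ E, ρ g x ≠ x) (χ : G →* K) :
    ∃ x ∈ E, x ≠ 0 ∧ ∀ g, ρ g x = algebraMap K L (χ g) * x := by
  classical
  cases nonempty_fintype G
  let f : G → (E →* L) := fun g => ((ρ g : L →* L)).comp (E.val : E →* L)
  have hf : Function.Injective f := by
    intro g h hgh
    by_contra hne
    obtain ⟨x, hx, hne'⟩ := hfaith (h⁻¹ * g) fun h1 => hne (inv_mul_eq_one.1 h1).symm
    refine hne' ?_
    have : ρ g x = ρ h x := DFunLike.congr_fun hgh ⟨x, hx⟩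
    rw [map_mul, AlgEquiv.mul_apply, this, ← AlgEquiv.mul_apply, ← map_mul, inv_mul_cancel, map_one,
      AlgEquiv.one_apply]
  have hlin := (linearIndependent_monoidHom E L).comp f hf
  rw [Fintype.linearIndependent_iff] at hlin
  have hex : ∃ x : E, ∑ g, algebraMap K L (χ g⁻¹) * ρ g x ≠ 0 := by
    by_contra! hall
    have h1 := hlin (fun g => algebraMap K L (χ g⁻¹)) (by
      funext x
      simpa [Finset.sum_apply, f] using hall x) 1
    simp at h1
  obtain ⟨x, hx⟩ := hex
  refine ⟨_, E.sum_mem fun g _ => E.mul_mem (E.algebraMap_mem _) (hE g x x.2), hx, fun h => ?_⟩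
  rw [map_sum, Finset.mul_sum]
  refine Fintype.sum_equiv (Equiv.mulLeft h) _ _ fun g => ?_
  have hχ : χ h * χ (h * g)⁻¹ = χ g⁻¹ := by
    rw [mul_inv_rev, map_mul, mul_left_comm, ← map_mul, mul_inv_cancel, map_one, mul_one]
  rw [Equiv.coe_mulLeft, ← mul_assoc, ← map_mul, hχ, map_mul, AlgEquiv.commutes, map_mul,
    AlgEquiv.mul_apply]

lemma galAction_algebraMap (K : Type*) [Field K] {G : Type*} [Group G] (g : G)
    (F : MvPolynomial G K) :
    galAction K G g (algebraMap _ (FnField K G) F) =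
      algebraMap _ (FnField K G) (MvPolynomial.rename (g * ·) F) := by
  simp only [galAction, permGalAction, MonoidHom.comp_apply,
    IsFractionRing.fieldEquivOfAlgEquivHom_apply, IsFractionRing.fieldEquivOfAlgEquiv_algebraMap]
  rfl

lemma trdeg_eq_algebraTrdeg (K L : Type*) [CommRing K] [CommRing L] [Algebra K L] :
    trdeg K L = Algebra.trdeg K L := rfl

open IntermediateField.algebraAdjoinAdjoin in
lemma trdeg_adjoin_range_le {K L : Type*} [Field K] [Field L] [Algebra K L] {r : ℕ}
    (y : Fin r → L) : trdeg K (IntermediateField.adjoin K (Set.range y)) ≤ r := by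
  rw [trdeg_eq_algebraTrdeg, ← trdeg_add_eq K (Algebra.adjoin K (Set.range y)),
    trdeg_eq_zero (R := Algebra.adjoin K (Set.range y)), add_zero, Algebra.adjoin_range_eq_range_aeval]
  have h := lift_trdeg_le_of_surjective (MvPolynomial.aeval (R := K) y).rangeRestrict
    (MvPolynomial.aeval (R := K) y).rangeRestrict_surjective
  rw [MvPolynomial.trdeg_of_isDomain] at h
  simpa using h

lemma natCast_ne_zero_of_ringChar_ne {K : Type*} [Field K] {p : ℕ} (hp : p.Prime)
    (h : ringChar K ≠ p) : (p : K) ≠ 0 := by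
  intro h0
  rcases (Nat.dvd_prime hp).1 (ringChar.dvd h0) with h1 | h1
  · exact CharP.ringChar_ne_one h1
  · exact h h1

section ElementaryAbelian

open MvPolynomial

variable {K : Type*} [Field K] {p r : ℕ}

/-- The linear character of `(ℤ/pℤ)^r` attached to a vector `s` and an additive character. -/
def vecChar (Ψ : AddChar (Fin r → ZMod p) K) (s : Fin r → ZMod p) :
    (Fin r → Multiplicative (ZMod p)) →* K where
  toFun g := Ψ (s * fun i => (g i).toAdd)
  map_one' := by
    rw [← Ψ.map_zero_eq_one]
    congr 1
    ext i
    simp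
  map_mul' g h := by
    rw [← Ψ.map_add_eq_mul, ← mul_add]
    rfl

lemma vecChar_apply (Ψ : AddChar (Fin r → ZMod p) K) (s : Fin r → ZMod p)
    (g : Fin r → Multiplicative (ZMod p)) :
    vecChar Ψ s g = Ψ (s * fun i => (g i).toAdd) := rfl

lemma vecChar_ne_zero (Ψ : AddChar (Fin r → ZMod p) K) (s : Fin r → ZMod p)
    (g : Fin r → Multiplicative (ZMod p)) : vecChar Ψ s g ≠ 0 :=
  (Group.isUnit g).map (vecChar Ψ s) |>.ne_zero

lemma vecChar_add (Ψ : AddChar (Fin r → ZMod p) K) (s t : Fin r → ZMod p)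
    (g : Fin r → Multiplicative (ZMod p)) :
    vecChar Ψ (s + t) g = vecChar Ψ s g * vecChar Ψ t g := by
  rw [vecChar_apply, add_mul, Ψ.map_add_eq_mul]
  rfl

lemma vecChar_sum_nsmul {ι : Type*} (Ψ : AddChar (Fin r → ZMod p) K) (S : Finset ι)
    (s : ι → Fin r → ZMod p) (n : ι → ℕ) (g : Fin r → Multiplicative (ZMod p)) :
    vecChar Ψ (∑ i ∈ S, n i • s i) g = ∏ i ∈ S, vecChar Ψ (s i) g ^ n i := by
  classical
  induction S using Finset.induction_on with
  | empty => simp [vecChar_apply]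
  | insert i S hi ih =>
    rw [Finset.sum_insert hi, Finset.prod_insert hi, vecChar_add, ih, vecChar_apply,
      smul_mul_assoc, AddChar.map_nsmul_eq_pow, vecChar_apply]

lemma vecChar_injective {Ψ : AddChar (Fin r → ZMod p) K} (hΨ : Ψ.IsPrimitive)
    {s t : Fin r → ZMod p} (h : ∀ g, vecChar Ψ s g = vecChar Ψ t g) : s = t := by
  refine AddChar.to_mulShift_inj_of_isPrimitive hΨ ?_
  ext x
  simpa [vecChar_apply] using! h fun i => Multiplicative.ofAdd (x i)

variable [NeZero p]

lemma sum_vecChar {Ψ : AddChar (Fin r → ZMod p) K} (hΨ : Ψ.IsPrimitive)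
    (g : Fin r → Multiplicative (ZMod p)) [Decidable (g = 1)] :
    ∑ s, vecChar Ψ s g = if g = 1 then (Fintype.card (Fin r → ZMod p) : K) else 0 := by
  classical
  have := AddChar.sum_mulShift (fun i => (g i).toAdd) hΨ
  have h0 : ((fun i => (g i).toAdd) = 0) ↔ g = 1 := Iff.rfl
  simp only [vecChar_apply, this, h0]
  split_ifs <;> simp

/-- The change of variables diagonalizing the regular representation of `(ℤ/pℤ)^r`. -/
def diagonalization (Ψ : AddChar (Fin r → ZMod p) K) :
    MvPolynomial (Fin r → Multiplicative (ZMod p)) K →ₐ[K] MvPolynomial (Fin r → ZMod p) K :=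
  aeval fun g => ∑ s, C (vecChar Ψ s g) * X s

lemma diagonalization_injective {Ψ : AddChar (Fin r → ZMod p) K} (hΨ : Ψ.IsPrimitive)
    (hp : (p : K) ≠ 0) : Function.Injective (diagonalization Ψ) := by
  classical
  let φ : MvPolynomial (Fin r → ZMod p) K →ₐ[K]
      MvPolynomial (Fin r → Multiplicative (ZMod p)) K :=
    aeval fun s => C ((Fintype.card (Fin r → ZMod p) : K)⁻¹) * ∑ h, C (vecChar Ψ s h⁻¹) * X h
  have hcard : (Fintype.card (Fin r → ZMod p) : K) ≠ 0 := by
    simp [ZMod.card, hp]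
  have hcomp : φ.comp (diagonalization Ψ) = AlgHom.id K _ := by
    ext1 g
    simp only [AlgHom.comp_apply, diagonalization, aeval_X, map_sum, map_mul, φ, algHom_C,
      AlgHom.id_apply, algebraMap_eq]
    have : ∀ h, ∑ s, vecChar Ψ s g * vecChar Ψ s h⁻¹ =
        if g = h then (Fintype.card (Fin r → ZMod p) : K) else 0 := by
      intro h
      simp_rw [← map_mul, sum_vecChar hΨ, mul_inv_eq_one]
    calc ∑ s, C (vecChar Ψ s g) * (C ((Fintype.card (Fin r → ZMod p) : K)⁻¹) *
          ∑ h, C (vecChar Ψ s h⁻¹) * X h)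
        = C ((Fintype.card (Fin r → ZMod p) : K)⁻¹) *
          ∑ h, C (∑ s, vecChar Ψ s g * vecChar Ψ s h⁻¹) * X h := by
          simp only [map_sum, map_mul, Finset.mul_sum, Finset.sum_mul]
          rw [Finset.sum_comm]
          exact Finset.sum_congr rfl fun _ _ => Finset.sum_congr rfl fun _ _ => by ring
      _ = X g := by
          simp only [this]
          rw [Finset.sum_eq_single g]
          · rw [if_pos rfl, ← mul_assoc, ← C_mul, inv_mul_cancel₀ hcard, C_1, one_mul]
          · intro h _ hne
            rw [if_neg hne.symm, C_0, zero_mul]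
          · simp
  exact Function.LeftInverse.injective (g := φ) fun F => DFunLike.congr_fun hcomp F

lemma diagonalization_rename (Ψ : AddChar (Fin r → ZMod p) K)
    (g : Fin r → Multiplicative (ZMod p))
    (F : MvPolynomial (Fin r → Multiplicative (ZMod p)) K) :
    diagonalization Ψ (rename (g * ·) F) =
      aeval (fun s => C (vecChar Ψ s g) * X s) (diagonalization Ψ F) := by
  have : (diagonalization Ψ).comp (rename (g * ·)) =
      (aeval fun s => C (vecChar Ψ s g) * X s).comp (diagonalization Ψ) := by
    ext1 h
    simp only [AlgHom.comp_apply, diagonalization, rename_X, aeval_X, map_sum, map_mul,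
      algHom_C, algebraMap_eq]
    exact Finset.sum_congr rfl fun _ _ => by ring
  exact DFunLike.congr_fun this F

/-- The weight of the monomial with (integral) exponent vector `x`. -/
def monomialWeight (p r : ℕ) [NeZero p] : ((Fin r → ZMod p) → ℤ) →+ (Fin r → ZMod p) where
  toFun x := ∑ s, x s • s
  map_zero' := by simp
  map_add' x y := by simp [add_smul, Finset.sum_add_distrib]

lemma leadingCoeff_diagonalization_rename (M : MonomialOrder (Fin r → ZMod p))
    (Ψ : AddChar (Fin r → ZMod p) K) (g : Fin r → Multiplicative (ZMod p))
    (F : MvPolynomial (Fin r → Multiplicative (ZMod p)) K) :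
    M.leadingCoeff (diagonalization Ψ (rename (g * ·) F)) =
      vecChar Ψ (monomialWeight p r fun s => M.degree (diagonalization Ψ F) s) g *
        M.leadingCoeff (diagonalization Ψ F) := by
  rw [diagonalization_rename, MonomialOrder.leadingCoeff,
    degree_aeval_C_mul_X M _ fun s => vecChar_ne_zero Ψ s g, coeff_aeval_C_mul_X,
    Finsupp.prod_fintype _ _ fun _ => pow_zero _, MonomialOrder.leadingCoeff]
  congr 1
  simp only [monomialWeight, AddMonoidHom.coe_mk, ZeroHom.coe_mk, natCast_zsmul,
    vecChar_sum_nsmul]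

/-- Eigenvectors whose weights are the standard basis vectors are algebraically independent. -/
lemma algebraicIndependent_of_eigenvector {Ψ : AddChar (Fin r → ZMod p) K} (hΨ : Ψ.IsPrimitive)
    (hp1 : 1 < p) (hp : (p : K) ≠ 0)
    (e : Fin r → FnField K (Fin r → Multiplicative (ZMod p))) (he0 : ∀ i, e i ≠ 0)
    (he : ∀ i g, galAction K _ g (e i) = algebraMap K _ (vecChar Ψ (Pi.single i 1) g) * e i) :
    AlgebraicIndependent K e := by
  classical
  let A := MvPolynomial (Fin r → Multiplicative (ZMod p)) K
  have hinj := diagonalization_injective hΨ hp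
  let _ : LinearOrder (Fin r → ZMod p) := linearOrderOfSTO WellOrderingRel
  let M : MonomialOrder (Fin r → ZMod p) := MonomialOrder.lex
  obtain ⟨b, hb⟩ := IsLocalization.exist_integer_multiples_of_finite (nonZeroDivisors A) e
  choose a ha using hb
  let L := FnField K (Fin r → Multiplicative (ZMod p))
  have ha' : ∀ i, algebraMap A L (a i) = algebraMap A L b * e i :=
    fun i => by rw [ha, Algebra.smul_def]
  have hb0 : (b : A) ≠ 0 := nonZeroDivisors.ne_zero b.2
  have hinjL := IsFractionRing.injective A L
  have ha0 : ∀ i, a i ≠ 0 := fun i h => by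
    have h1 := ha' i
    rw [h, map_zero, zero_eq_mul, map_eq_zero_iff _ hinjL] at h1
    exact h1.elim hb0 (he0 i)
  refine algebraicIndependent_of_linearIndependent_degree M (diagonalization Ψ) hinj e a b ha0 hb0
    ha' (linearIndependent_int_of_map_eq_single hp1 _ (monomialWeight p r) fun i => ?_)
  refine (map_sub (monomialWeight p r) (fun s => (M.degree (diagonalization Ψ (a i)) s : ℤ))
    fun s => (M.degree (diagonalization Ψ (b : A)) s : ℤ)).trans (sub_eq_iff_eq_add.2 ?_)
  refine vecChar_injective hΨ fun g => ?_
  have hA : rename (g * ·) (a i) * (b : A) =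
      C (vecChar Ψ (Pi.single i 1) g) * a i * rename (g * ·) (b : A) := by
    apply hinjL
    have h1 := congrArg (galAction K _ g) (ha' i)
    rw [map_mul, galAction_algebraMap, galAction_algebraMap, he] at h1
    rw [map_mul, map_mul, map_mul, h1, ha', ← algebraMap_eq, ← IsScalarTower.algebraMap_apply]
    ring
  have hlc := congrArg (fun F => M.leadingCoeff (diagonalization Ψ F)) hA
  simp only [map_mul, M.leadingCoeff_mul, leadingCoeff_diagonalization_rename] at hlc
  rw [← algebraMap_eq, AlgHom.commutes, algebraMap_eq, M.leadingCoeff_C] at hlc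
  have hla : M.leadingCoeff (diagonalization Ψ (a i)) ≠ 0 :=
    M.leadingCoeff_ne_zero_iff.2 ((map_ne_zero_iff _ hinj).2 (ha0 i))
  have hlb : M.leadingCoeff (diagonalization Ψ (b : A)) ≠ 0 :=
    M.leadingCoeff_ne_zero_iff.2 ((map_ne_zero_iff _ hinj).2 hb0)
  rw [vecChar_add]
  refine mul_right_cancel₀ (mul_ne_zero hla hlb) ?_
  linear_combination hlc

/-- The linear form of weight `s` in the regular representation. -/
def weightForm (Ψ : AddChar (Fin r → ZMod p) K) (s : Fin r → ZMod p) :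
    MvPolynomial (Fin r → Multiplicative (ZMod p)) K :=
  ∑ h, C (vecChar Ψ s h⁻¹) * X h

lemma weightForm_ne_zero (Ψ : AddChar (Fin r → ZMod p) K) (s : Fin r → ZMod p) :
    weightForm Ψ s ≠ 0 := by
  classical
  intro h
  have h1 := congrArg (coeff (Finsupp.single 1 1)) h
  simp only [weightForm, coeff_sum, coeff_C_mul, coeff_X, coeff_zero] at h1
  rw [Finset.sum_eq_single 1] at h1
  · simp at h1
  · intro g _ hg
    rw [if_neg, mul_zero]
    exact fun h => hg (Finsupp.single_left_injective one_ne_zero h)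
  · simp

lemma galAction_weightForm (Ψ : AddChar (Fin r → ZMod p) K) (s : Fin r → ZMod p)
    (g : Fin r → Multiplicative (ZMod p)) :
    galAction K _ g (algebraMap _ (FnField K (Fin r → Multiplicative (ZMod p)))
        (weightForm Ψ s)) = algebraMap K _ (vecChar Ψ s g) *
      algebraMap _ (FnField K (Fin r → Multiplicative (ZMod p))) (weightForm Ψ s) := by
  rw [galAction_algebraMap, IsScalarTower.algebraMap_apply K
    (MvPolynomial (Fin r → Multiplicative (ZMod p)) K), ← map_mul]
  congr 1
  simp only [weightForm, map_sum, map_mul, rename_X, rename_C, algebraMap_eq, Finset.mul_sum]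
  refine Fintype.sum_equiv (Equiv.mulLeft g) _ _ fun h => ?_
  rw [Equiv.coe_mulLeft, ← mul_assoc, ← C_mul, ← map_mul, mul_inv_rev, mul_inv_cancel_comm_assoc]

theorem edK_eq_of_isPrimitiveRoot (hp : p.Prime) (hpK : (p : K) ≠ 0) {ζ : K}
    (hζ : IsPrimitiveRoot ζ p) : edK K (Fin r → Multiplicative (ZMod p)) = r := by
  classical
  let ε : AddChar (ZMod p) K := AddChar.zmodChar p hζ.pow_eq_one
  have hε : ∀ a, ε a = 1 → a = 0 := fun a h =>
    ((AddChar.zmodChar_primitive_of_primitive_root p hζ).zmod_char_eq_one_iff p a).1 h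
  let Ψ : AddChar (Fin r → ZMod p) K :=
    { toFun := fun s => ε (∑ i, s i)
      map_zero_eq_one' := by simp
      map_add_eq_mul' := fun s t => by
        rw [← ε.map_add_eq_mul, ← Finset.sum_add_distrib]
        rfl }
  have hΨsingle : ∀ (s : Fin r → ZMod p) i, Ψ (s * Pi.single i 1) = ε (s i) := fun s i => by
    change ε (∑ j, (s * Pi.single i 1 : Fin r → ZMod p) j) = ε (s i)
    simp [Pi.single_apply]
  have hΨ : Ψ.IsPrimitive := fun s hs h => by
    refine hs (funext fun i => hε _ ?_)
    rw [← hΨsingle]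
    exact DFunLike.congr_fun h (Pi.single i 1)
  let y : Fin r → FnField K (Fin r → Multiplicative (ZMod p)) :=
    fun i => algebraMap _ _ (weightForm Ψ (Pi.single i 1))
  let E := IntermediateField.adjoin K (Set.range y)
  have hstable : ∀ g, ∀ x ∈ E, galAction K _ g x ∈ E := by
    intro g
    suffices h : E ≤ E.comap (galAction K _ g : _ →ₐ[K] _) from h
    rw [IntermediateField.adjoin_le_iff]
    rintro _ ⟨i, rfl⟩
    change galAction K _ g (y i) ∈ E
    rw [galAction_weightForm]
    exact E.mul_mem (E.algebraMap_mem _)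
      (IntermediateField.subset_adjoin K _ (Set.mem_range_self i))
  have hfaith : ∀ g, g ≠ 1 → ∃ x ∈ E, galAction K _ g x ≠ x := by
    intro g hg
    obtain ⟨i, hi⟩ := Function.ne_iff.1 hg
    refine ⟨y i, IntermediateField.subset_adjoin K _ (Set.mem_range_self i), fun h => hi ?_⟩
    have hy : y i ≠ 0 :=
      (map_ne_zero_iff _ (IsFractionRing.injective _ _)).2 (weightForm_ne_zero _ _)
    rw [galAction_weightForm, mul_eq_right₀ hy, map_eq_one_iff _ (algebraMap K _).injective,
      vecChar_apply, mul_comm, hΨsingle] at h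
    exact hε _ h
  have htrdeg : trdeg K E ≤ r := trdeg_adjoin_range_le y
  have hlower : ∀ d : ℕ, (∃ E : IntermediateField K (FnField K (Fin r → Multiplicative (ZMod p))),
      (∀ g, ∀ x ∈ E, galAction K _ g x ∈ E) ∧ (∀ g, g ≠ 1 → ∃ x ∈ E, galAction K _ g x ≠ x) ∧
      trdeg K E = d) → r ≤ d := by
    rintro d ⟨E, hE, hEf, hEd⟩
    choose e heE he0 he using fun i =>
      exists_eigenvector (galAction K _) E hE hEf (vecChar Ψ (Pi.single i 1))
    have hind := algebraicIndependent_of_eigenvector hΨ hp.one_lt hpK e he0 he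
    have hindE : AlgebraicIndependent K fun i => (⟨e i, heE i⟩ : E) :=
      AlgebraicIndependent.of_comp E.val hind
    have := hindE.lift_cardinalMk_le_trdeg
    rw [← trdeg_eq_algebraTrdeg, hEd] at this
    simpa using this
  obtain ⟨d, hd⟩ := Cardinal.lt_aleph0.1 (htrdeg.trans_lt Cardinal.natCast_lt_aleph0)
  have hdmem : ∃ E : IntermediateField K (FnField K (Fin r → Multiplicative (ZMod p))),
      (∀ g, ∀ x ∈ E, galAction K _ g x ∈ E) ∧ (∀ g, g ≠ 1 → ∃ x ∈ E, galAction K _ g x ≠ x) ∧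
      trdeg K E = d := ⟨E, hstable, hfaith, hd⟩
  have hdr : d ≤ r := by
    rw [hd] at htrdeg
    exact_mod_cast htrdeg
  exact le_antisymm ((Nat.sInf_le hdmem).trans hdr)
    (le_csInf ⟨d, hdmem⟩ fun d hd => hlower d hd)

end ElementaryAbelian

/-- Let `p` be a prime and `K` a field with `char K ≠ p` containing a primitive `p`-th
root of unity. Then `ed_K((ℤ/pℤ)^r) = r` for every `r ≥ 1`. In particular, for a field
of characteristic different from `2`, `ed_K((ℤ/2ℤ)^r) = r`. -/
theorem edK_elementaryAbelian (K : Type*) [Field K] (p : ℕ) (hp : p.Prime)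
    (hchar : ringChar K ≠ p) (ζ : K) (hζ : IsPrimitiveRoot ζ p) (r : ℕ) (hr : 0 < r) :
    edK K (Fin r → Multiplicative (ZMod p)) = r ∧
    ∀ (K₂ : Type*) [Field K₂], ringChar K₂ ≠ 2 →
      edK K₂ (Fin r → Multiplicative (ZMod 2)) = r := by
  refine ⟨?_, fun K₂ _ h2 => ?_⟩
  · have := NeZero.mk hp.ne_zero
    exact edK_eq_of_isPrimitiveRoot hp (natCast_ne_zero_of_ringChar_ne hp hchar) hζ
  · exact edK_eq_of_isPrimitiveRoot Nat.prime_two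
      (natCast_ne_zero_of_ringChar_ne Nat.prime_two h2) (IsPrimitiveRoot.neg_one (ringChar K₂) h2)
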